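/- Consider the MMAHH with acceptance operators OI and OW on f = OneMax, with p, q ∈ (0,1), started from an arbitrary x_0 ∈ L_k and s_0 = OI, where k ∈ [0..n]. For h ∈ [0..n] let p_k^h = Pr[y_{T_s^{(1)}} ≤ h]. Then p_k^h = 1 if k ≤ h, and p_k^h = (1/(1−p)) · (Γ(k+1)·Γ(n·p/(1−p) + h + 1)) / (Γ(h+1)·Γ(n·p/(1−p) + k + 1)) if k > h; in particular this probability does not depend on the choice of x_0 ∈ L_k nor on q. -/

import Mathlib

open MeasureTheory
open scoped ENNReal NNReal

namespace MMAHHStmt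

/-- The two acceptance operators. -/
inductive Op : Type
  | OI : Op
  | OW : Op
  deriving DecidableEq

instance : MeasurableSpace Op := ⊤

/-- Search points: bit-strings of length `n`. -/
abbrev Point (n : ℕ) := Fin n → Bool

/-- The number of one-bits of a bit-string. -/
def ones {n : ℕ} (x : Point n) : ℕ := (Finset.univ.filter fun i => x i = true).card

/-- The all-ones string, the global optimum of all benchmarks considered. -/
def optimum (n : ℕ) : Point n := fun _ => true

/-- Flipping the bit in position `v`. -/
def flipBit {n : ℕ} (x : Point n) (v : Fin n) : Point n := Function.update x v (!(x v))

open Classical in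
/-- The search point obtained from `x` by proposing to flip bit `v` and applying the
acceptance operator `op` for the objective function `f`. -/
noncomputable def movedPoint {n : ℕ} (f : Point n → ℝ) (op : Op) (x : Point n) (v : Fin n) :
    Point n :=
  match op with
  | Op.OI => if f x < f (flipBit x v) then flipBit x v else x
  | Op.OW => if f (flipBit x v) < f x then flipBit x v else x

open Classical in
/-- One-step transition probability of the search point under acceptance operator `op`:
a uniformly random bit is flipped and the move is accepted or rejected according to `op`. -/
noncomputable def moveProb {n : ℕ} (f : Point n → ℝ) (op : Op) (x x' : Point n) : ℝ≥0∞ :=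
  ((Finset.univ.filter fun v => movedPoint f op x v = x').card : ℝ≥0∞) / n

/-- Transition probabilities of the two-state Markov chain on the acceptance operators. -/
noncomputable def switchProb (p q : ℝ) : Op → Op → ℝ≥0∞
  | Op.OI, Op.OI => ENNReal.ofReal (1 - p)
  | Op.OI, Op.OW => ENNReal.ofReal p
  | Op.OW, Op.OI => ENNReal.ofReal q
  | Op.OW, Op.OW => ENNReal.ofReal (1 - q)

/-- One-step transition probabilities of the MMAHH on the state space
`Point n × Op`: the search point moves according to the current acceptance operator, and,
independently, the operator switches according to the two-state Markov chain. -/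
noncomputable def mmahhTrans {n : ℕ} (f : Point n → ℝ) (p q : ℝ) :
    Point n × Op → Point n × Op → ℝ≥0∞ :=
  fun s s' => moveProb f s.2 s.1 s'.1 * switchProb p q s.2 s'.2

/-- `X` is (a version of) the MMAHH Markov chain with objective function `f` and switching
probabilities `p` and `q`, under the measure `μ`: each `X t` is measurable, and conditionally
on any history, the next state is distributed according to `mmahhTrans`. -/
def IsMMAHH {n : ℕ} {Ω : Type*} [MeasurableSpace Ω] (μ : Measure Ω)
    (X : ℕ → Ω → Point n × Op) (f : Point n → ℝ) (p q : ℝ) : Prop :=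
  (∀ t, Measurable (X t)) ∧
  ∀ (t : ℕ) (σ : ℕ → Point n × Op) (s' : Point n × Op),
    μ {ω | (∀ i ≤ t, X i ω = σ i) ∧ X (t + 1) ω = s'}
      = μ {ω | ∀ i ≤ t, X i ω = σ i} * mmahhTrans f p q (σ t) s'

/-- The runtime: the first hitting time of the global optimum, as an extended natural number
(`⊤` if the optimum is never reached). -/
noncomputable def hitTime {n : ℕ} {Ω : Type*} (X : ℕ → Ω → Point n × Op) (ω : Ω) : ℕ∞ :=
  ⨅ t ∈ {t : ℕ | (X t ω).1 = optimum n}, (t : ℕ∞)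

/-- The `k`-th switching time between the two acceptance operators (with junk value given by
`Nat.sInf ∅ = 0` on the probability-zero event that no further switch occurs). -/
noncomputable def switchTime {n : ℕ} {Ω : Type*} (X : ℕ → Ω → Point n × Op) : ℕ → Ω → ℕ
  | 0, _ => 0
  | k + 1, ω =>
      sInf {t : ℕ | switchTime X k ω ≤ t ∧ (X t ω).2 ≠ (X (switchTime X k ω) ω).2}

/-- The OneMax benchmark. -/
noncomputable def OneMax (n : ℕ) (x : Point n) : ℝ := (ones x : ℝ)

instance : Fintype Op := ⟨{Op.OI, Op.OW}, by intro x; cases x <;> simp⟩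

instance : DiscreteMeasurableSpace Op := ⟨fun _ => trivial⟩

/-- Mass of the paths staying in `OI` up to time `t` and being at `x` at time `t`. -/
noncomputable def stayMass {n : ℕ} {Ω : Type*} [MeasurableSpace Ω] (μ : Measure Ω)
    (X : ℕ → Ω → Point n × Op) (t : ℕ) (x : Point n) : ℝ≥0∞ :=
  μ {ω | (∀ i ≤ t, (X i ω).2 = Op.OI) ∧ (X t ω).1 = x}

lemma meas_set {n : ℕ} {Ω : Type*} [MeasurableSpace Ω] {X : ℕ → Ω → Point n × Op}
    (hX : ∀ t, Measurable (X t)) (t : ℕ) (A : Set (Point n × Op)) :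
    MeasurableSet {ω | X t ω ∈ A} := hX t (Set.toFinite A).measurableSet

lemma meas_stay {n : ℕ} {Ω : Type*} [MeasurableSpace Ω] {X : ℕ → Ω → Point n × Op}
    (hX : ∀ t, Measurable (X t)) (t : ℕ) :
    MeasurableSet {ω | ∀ i ≤ t, (X i ω).2 = Op.OI} := by
  have : {ω | ∀ i ≤ t, (X i ω).2 = Op.OI} = ⋂ i, ⋂ (_ : i ≤ t), {ω | X i ω ∈ {s | s.2 = Op.OI}} := by
    ext ω; simp
  rw [this]
  exact MeasurableSet.iInter fun i => MeasurableSet.iInter fun _ => meas_set hX i _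

lemma markov_step {n : ℕ} {Ω : Type*} [MeasurableSpace Ω] (μ : Measure Ω)
    (X : ℕ → Ω → Point n × Op) (f : Point n → ℝ) (p q : ℝ) (hc : IsMMAHH μ X f p q)
    (t : ℕ) (x : Point n) (s' : Point n × Op) :
    μ {ω | ((∀ i ≤ t, (X i ω).2 = Op.OI) ∧ (X t ω).1 = x) ∧ X (t+1) ω = s'}
      = stayMass μ X t x * mmahhTrans f p q (x, Op.OI) s' := by
  classical
  obtain ⟨hX, hM⟩ := hc
  let Y : Ω → (Fin (t+1) → Point n × Op) := fun ω i => X i ω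
  have hY : Measurable Y := measurable_pi_lambda _ fun i => hX i
  let F : Finset (Fin (t+1) → Point n × Op) :=
    Finset.univ.filter fun y => (∀ i, (y i).2 = Op.OI) ∧ (y (Fin.last t)).1 = x
  have hset : {ω | (∀ i ≤ t, (X i ω).2 = Op.OI) ∧ (X t ω).1 = x} = Y ⁻¹' (F : Set _) := by
    ext ω
    simp only [Set.mem_ofPred_eq, Set.mem_preimage, F, Finset.coe_filter, Finset.mem_univ, true_and, Y,
      Fin.val_last]
    constructor
    · rintro ⟨h1, h2⟩; exact ⟨fun i => h1 i (by omega), h2⟩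
    · rintro ⟨h1, h2⟩; exact ⟨fun i hi => h1 ⟨i, by omega⟩, h2⟩
  have hB : MeasurableSet {ω | X (t+1) ω = s'} := meas_set hX (t+1) {s'}
  have hsing : ∀ y : Fin (t+1) → Point n × Op, MeasurableSet (Y ⁻¹' {y}) :=
    fun y => hY (measurableSet_singleton y)
  have e1 : stayMass μ X t x = ∑ y ∈ F, μ (Y ⁻¹' {y}) := by
    rw [stayMass, hset, sum_measure_preimage_singleton F (fun y _ => hsing y)]
  have e2 : μ {ω | ((∀ i ≤ t, (X i ω).2 = Op.OI) ∧ (X t ω).1 = x) ∧ X (t+1) ω = s'}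
      = ∑ y ∈ F, (μ.restrict {ω | X (t+1) ω = s'}) (Y ⁻¹' {y}) := by
    rw [sum_measure_preimage_singleton F (fun y _ => hsing y), ← hset, Measure.restrict_apply' hB]
    rfl
  rw [e1, e2, Finset.sum_mul]
  refine Finset.sum_congr rfl fun y hy => ?_
  simp only [F, Finset.mem_filter, Finset.mem_univ, true_and] at hy
  rw [Measure.restrict_apply' hB]
  let σ : ℕ → Point n × Op := fun i => y ⟨min i t, by omega⟩
  have h1 : Y ⁻¹' {y} = {ω | ∀ i ≤ t, X i ω = σ i} := by
    ext ω
    simp only [Set.mem_preimage, Set.mem_singleton_iff, Set.mem_ofPred_eq, Y, σ, funext_iff]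
    constructor
    · intro h i hi
      have := h ⟨i, by omega⟩
      simpa [hi] using this
    · intro h i
      have := h i (by omega)
      have h3 : min (i:ℕ) t = i := by omega
      simpa [h3] using this
  have h2 : σ t = (x, Op.OI) := by
    have : σ t = y (Fin.last t) := by simp only [σ]; congr 1; ext; simp
    rw [this]
    exact Prod.ext hy.2 (hy.1 _)
  have := hM t σ s'
  rw [h2] at this
  rw [h1, ← this]
  rfl

lemma sum_moveProb {n : ℕ} (f : Point n → ℝ) (op : Op) (x : Point n) (ψ : Point n → ℝ≥0∞) :
    ∑ x', moveProb f op x x' * ψ x' = (∑ v, ψ (movedPoint f op x v)) / n := by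
  classical
  have : ∀ x', moveProb f op x x' * ψ x'
      = (∑ v, if movedPoint f op x v = x' then ψ x' else 0) / n := by
    intro x'
    rw [moveProb, ← Finset.sum_filter, Finset.sum_const, nsmul_eq_mul, ENNReal.div_eq_inv_mul,
      ENNReal.div_eq_inv_mul, mul_assoc]
  simp_rw [this, ENNReal.div_eq_inv_mul, ← Finset.mul_sum]
  rw [Finset.sum_comm]
  simp

lemma next_mass {n : ℕ} {Ω : Type*} [MeasurableSpace Ω] (μ : Measure Ω)
    (X : ℕ → Ω → Point n × Op) (f : Point n → ℝ) (p q : ℝ) (hc : IsMMAHH μ X f p q)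
    (t : ℕ) (s' : Point n × Op) :
    μ {ω | (∀ i ≤ t, (X i ω).2 = Op.OI) ∧ X (t+1) ω = s'}
      = ∑ x, stayMass μ X t x * mmahhTrans f p q (x, Op.OI) s' := by
  classical
  simp_rw [← markov_step μ X f p q hc]
  have hE := (meas_stay hc.1 t).inter (meas_set hc.1 (t+1) {s'})
  rw [← measure_biUnion_finset]
  · congr 1; ext ω; simp
  · intro a _ b _ hab
    rw [Function.onFun, Set.disjoint_left]
    rintro ω ⟨⟨_, h1⟩, _⟩ ⟨⟨_, h2⟩, _⟩
    exact hab (h1.symm.trans h2)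
  · intro x _
    have := hE.inter (meas_set hc.1 t {s | s.1 = x})
    convert this using 1
    ext ω; simp; tauto

lemma step_sum {n : ℕ} {Ω : Type*} [MeasurableSpace Ω] (μ : Measure Ω)
    (X : ℕ → Ω → Point n × Op) (f : Point n → ℝ) (p q : ℝ) (hc : IsMMAHH μ X f p q)
    (t : ℕ) (o : Op) (ψ : Point n → ℝ≥0∞) :
    ∑ x', μ {ω | (∀ i ≤ t, (X i ω).2 = Op.OI) ∧ X (t+1) ω = (x', o)} * ψ x'
      = ∑ x, stayMass μ X t x *
        (switchProb p q Op.OI o * ((∑ v, ψ (movedPoint f Op.OI x v)) / n)) := by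
  simp_rw [next_mass μ X f p q hc, ← sum_moveProb, Finset.sum_mul, Finset.mul_sum, mmahhTrans]
  rw [Finset.sum_comm]
  refine Finset.sum_congr rfl fun x _ => Finset.sum_congr rfl fun x' _ => ?_
  ring

lemma stay_succ {n : ℕ} {Ω : Type*} [MeasurableSpace Ω] (μ : Measure Ω)
    (X : ℕ → Ω → Point n × Op) (t : ℕ) (x : Point n) :
    stayMass μ X (t+1) x = μ {ω | (∀ i ≤ t, (X i ω).2 = Op.OI) ∧ X (t+1) ω = (x, Op.OI)} := by
  rw [stayMass]
  congr 1; ext ω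
  simp only [Set.mem_ofPred_eq, Prod.ext_iff]
  constructor
  · rintro ⟨h1, h2⟩; exact ⟨fun i hi => h1 i (by omega), h2, h1 _ le_rfl⟩
  · rintro ⟨h1, h2, h3⟩
    refine ⟨fun i hi => ?_, h2⟩
    rcases Nat.lt_or_ge t i with h | h
    · have : i = t+1 := by omega
      rw [this]; exact h3
    · exact h1 i h

lemma ones_le {n : ℕ} (x : Point n) : ones x ≤ n := by
  unfold ones
  exact (Finset.card_le_univ _).trans (by simp)

lemma ones_flip_false {n : ℕ} (x : Point n) (v : Fin n) (hv : x v = false) :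
    ones (flipBit x v) = ones x + 1 := by
  unfold ones
  rw [← Finset.card_insert_of_notMem (a := v) (s := Finset.univ.filter fun i => x i = true) (by simp [hv])]
  congr 1; ext i
  rw [Finset.mem_insert, Finset.mem_filter, Finset.mem_filter]
  by_cases h : i = v
  · subst h; simp [flipBit, hv]
  · simp [flipBit, h, Function.update_of_ne]

lemma ones_flip_true {n : ℕ} (x : Point n) (v : Fin n) (hv : x v = true) :
    ones (flipBit x v) + 1 = ones x := by
  have h := ones_flip_false (flipBit x v) v (by simp [flipBit, hv])
  rw [← h]; congr 1; ext i
  by_cases h : i = v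
  · subst h; simp [flipBit]
  · simp [flipBit, h]

lemma ones_moved {n : ℕ} (x : Point n) (v : Fin n) :
    ones (movedPoint (OneMax n) Op.OI x v) = if x v = true then ones x else ones x + 1 := by
  unfold movedPoint OneMax
  cases hv : x v
  · have := ones_flip_false x v hv
    simp [this]
  · have := ones_flip_true x v hv
    have h : ¬ ((ones x : ℝ) < (ones (flipBit x v) : ℝ)) := by
      rw [Nat.cast_lt]; omega
    simp [h]

lemma sum_moved {n : ℕ} (x : Point n) (F : ℕ → ℝ≥0∞) :
    ∑ v, F (n - ones (movedPoint (OneMax n) Op.OI x v))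
      = (n - ones x : ℕ) * F (n - ones x - 1) + (ones x : ℕ) * F (n - ones x) := by
  simp_rw [ones_moved]
  have h0 : ∀ v, F (n - (if x v = true then ones x else ones x + 1))
     = if x v = true then F (n - ones x) else F (n - ones x - 1) := by
    intro v; split_ifs <;> simp [Nat.sub_sub]
  simp_rw [h0]
  rw [Finset.sum_ite, Finset.sum_const, Finset.sum_const, nsmul_eq_mul, nsmul_eq_mul, add_comm]
  have h1 : (Finset.univ.filter fun i => x i = true).card = ones x := rfl
  have h2 : (Finset.univ.filter fun i => ¬ x i = true).card = n - ones x := by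
    have := Finset.card_filter_add_card_filter_not (s := (Finset.univ : Finset (Fin n))) (fun i => x i = true)
    simp only [Finset.card_univ, Fintype.card_fin] at this
    omega
  rw [h1, h2]

/-- The closed form. -/
noncomputable def gform (n : ℕ) (p : ℝ) (h k : ℕ) : ℝ :=
  (1 / (1 - p)) *
        (Real.Gamma ((k : ℝ) + 1) * Real.Gamma ((n : ℝ) * p / (1 - p) + (h : ℝ) + 1)) /
        (Real.Gamma ((h : ℝ) + 1) * Real.Gamma ((n : ℝ) * p / (1 - p) + (k : ℝ) + 1))

noncomputable def gval (n : ℕ) (p : ℝ) (h k : ℕ) : ℝ := if k ≤ h then 1 else gform n p h k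

lemma gform_nonneg (n : ℕ) (p : ℝ) (h0 : 0 < p) (h1 : p < 1) (h k : ℕ) : 0 ≤ gform n p h k := by
  have h2 : 0 < 1 - p := by linarith
  have ha : 0 ≤ (n : ℝ) * p / (1 - p) := by positivity
  have := Real.Gamma_pos_of_pos (show 0 < (k:ℝ) + 1 by positivity)
  have := Real.Gamma_pos_of_pos (show 0 < (h:ℝ) + 1 by positivity)
  have := Real.Gamma_pos_of_pos (show 0 < (n : ℝ) * p / (1 - p) + (k:ℝ) + 1 by positivity)
  have := Real.Gamma_pos_of_pos (show 0 < (n : ℝ) * p / (1 - p) + (h:ℝ) + 1 by positivity)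
  unfold gform; positivity

lemma gval_nonneg (n : ℕ) (p : ℝ) (h0 : 0 < p) (h1 : p < 1) (h k : ℕ) : 0 ≤ gval n p h k := by
  unfold gval; split_ifs
  · norm_num
  · exact gform_nonneg n p h0 h1 h k

lemma gform_succ (n : ℕ) (p : ℝ) (h0 : 0 < p) (h1 : p < 1) (h k : ℕ) :
    (n * p + (k + 1) * (1 - p)) * gform n p h (k+1) = (k + 1) * (1 - p) * gform n p h k := by
  have h2 : 0 < 1 - p := by linarith
  have ha : 0 ≤ (n : ℝ) * p / (1 - p) := by positivity
  have e : (n * p + (k + 1) * (1 - p)) = (1 - p) * ((n : ℝ) * p / (1 - p) + k + 1) := by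
    field_simp
    ring
  rw [e]
  unfold gform
  generalize (n : ℝ) * p / (1 - p) = a at *
  have := Real.Gamma_pos_of_pos (show 0 < (h:ℝ) + 1 by positivity)
  have := Real.Gamma_pos_of_pos (show 0 < a + (k:ℝ) + 1 by positivity)
  have hk : a + (k:ℝ) + 1 ≠ 0 := by positivity
  push_cast
  rw [Real.Gamma_add_one (s := (k:ℝ)+1) (by positivity),
    ← add_assoc, Real.Gamma_add_one (s := a + (k:ℝ)+1) (by positivity)]
  field_simp

lemma gform_self (n : ℕ) (p : ℝ) (h0 : 0 < p) (h1 : p < 1) (h : ℕ) :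
    (1 - p) * gform n p h h = 1 := by
  have h2 : 0 < 1 - p := by linarith
  have ha : 0 ≤ (n : ℝ) * p / (1 - p) := by positivity
  unfold gform
  generalize (n : ℝ) * p / (1 - p) = a at *
  have := Real.Gamma_pos_of_pos (show 0 < (h:ℝ) + 1 by positivity)
  have := Real.Gamma_pos_of_pos (show 0 < a + (h:ℝ) + 1 by positivity)
  field_simp

/-- indicator of good layers -/
noncomputable def ind (h k : ℕ) : ℝ := if k ≤ h then 1 else 0

lemma ind_nonneg (h k : ℕ) : 0 ≤ ind h k := by unfold ind; split_ifs <;> norm_num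

lemma harmonic (n : ℕ) (p : ℝ) (h0 : 0 < p) (h1 : p < 1) (h k m : ℕ) (hkm : k + m = n) :
    p * (k * ind h (k-1) + m * ind h k) + (1 - p) * (k * gval n p h (k-1) + m * gval n p h k)
      = n * gval n p h k := by
  have hm : (m : ℝ) = n - k := by rw [← hkm]; push_cast; ring
  rw [hm]
  rcases Nat.lt_or_ge h k with hk | hk
  · obtain ⟨j, rfl⟩ : ∃ j, k = j + 1 := ⟨k-1, by omega⟩
    have hs := gform_succ n p h0 h1 h j
    have hj : ¬ (j + 1 ≤ h) := by omega
    rcases Nat.lt_or_ge h j with hj' | hj'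
    · have hj2 : ¬ (j ≤ h) := by omega
      simp only [ind, gval, Nat.add_sub_cancel, hj, hj2, if_false]
      push_cast
      linarith
    · have : j = h := by omega
      subst this
      have h3 := gform_self n p h0 h1 j
      simp only [ind, gval, Nat.add_sub_cancel, hj, le_refl, if_false, if_true]
      push_cast
      linear_combination (-1) * hs - ((j:ℝ)+1) * h3
  · have : k - 1 ≤ h := by omega
    simp only [ind, gval, hk, this, if_true]
    ring

lemma harmonic_enn (n : ℕ) (hn : 2 ≤ n) (p : ℝ) (h0 : 0 < p) (h1 : p < 1) (h : ℕ) (x : Point n) :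
    ENNReal.ofReal p *
        ((∑ v, ENNReal.ofReal (ind h (n - ones (movedPoint (OneMax n) Op.OI x v)))) / n)
      + ENNReal.ofReal (1 - p) *
        ((∑ v, ENNReal.ofReal (gval n p h (n - ones (movedPoint (OneMax n) Op.OI x v)))) / n)
      = ENNReal.ofReal (gval n p h (n - ones x)) := by
  have hle := ones_le x
  have hh := harmonic n p h0 h1 h (n - ones x) (ones x) (by omega)
  rw [sum_moved x (fun k => ENNReal.ofReal (ind h k)),
    sum_moved x (fun k => ENNReal.ofReal (gval n p h k))]
  generalize n - ones x = k at *
  generalize ones x = m at *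
  have i1 := ind_nonneg h k
  have i2 := ind_nonneg h (k-1)
  have g1 := gval_nonneg n p h0 h1 h k
  have g2 := gval_nonneg n p h0 h1 h (k-1)
  have h2 : 0 ≤ 1 - p := by linarith
  have hn0 : (0:ℝ) < n := by exact_mod_cast (by omega : 0 < n)
  simp only [← ENNReal.ofReal_natCast]
  rw [← ENNReal.ofReal_mul (by positivity), ← ENNReal.ofReal_mul (by positivity),
    ← ENNReal.ofReal_mul (by positivity), ← ENNReal.ofReal_mul (by positivity),
    ← ENNReal.ofReal_add (by positivity) (by positivity),
    ← ENNReal.ofReal_add (by positivity) (by positivity),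
    ← ENNReal.ofReal_div_of_pos hn0, ← ENNReal.ofReal_div_of_pos hn0,
    ← ENNReal.ofReal_mul (by positivity), ← ENNReal.ofReal_mul (by positivity),
    ← ENNReal.ofReal_add (by positivity) (by positivity)]
  congr 1
  rw [mul_div_assoc', mul_div_assoc', ← add_div, hh]
  field_simp

section main

variable {n : ℕ} {Ω : Type*} [MeasurableSpace Ω] (μ : Measure Ω) (X : ℕ → Ω → Point n × Op)

lemma total_mass (hX : ∀ t, Measurable (X t)) (t : ℕ) :
    μ {ω | ∀ i ≤ t, (X i ω).2 = Op.OI} = ∑ x, stayMass μ X t x := by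
  unfold stayMass
  rw [← measure_biUnion_finset]
  · congr 1; ext ω; simp
  · intro a _ b _ hab
    rw [Function.onFun, Set.disjoint_left]
    rintro ω ⟨_, h1⟩ ⟨_, h2⟩
    exact hab (h1.symm.trans h2)
  · intro x _
    exact (meas_stay hX t).inter (meas_set hX t {s | s.1 = x})

lemma total_decay [IsProbabilityMeasure μ] (hn : 2 ≤ n) (f : Point n → ℝ) (p q : ℝ)
    (hc : IsMMAHH μ X f p q) (t : ℕ) :
    ∑ x, stayMass μ X t x ≤ ENNReal.ofReal (1 - p) ^ t := by
  induction t with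
  | zero => rw [← total_mass μ X hc.1]; simpa using prob_le_one
  | succ t ih =>
    have := step_sum μ X f p q hc t Op.OI (fun _ => 1)
    have hn0 : (n : ℝ≥0∞) ≠ 0 := by simp; omega
    simp only [mul_one, ← stay_succ, Finset.sum_const, Finset.card_univ, Fintype.card_fin,
      nsmul_eq_mul, ENNReal.div_self hn0 (ENNReal.natCast_ne_top n), switchProb,
      ← Finset.sum_mul] at this
    rw [this, pow_succ]
    gcongr

/-- event that the first switch is at time `t+1`, into a good layer -/
def goodAt (h t : ℕ) : Set Ω :=
  {ω | (∀ i ≤ t, (X i ω).2 = Op.OI) ∧ (X (t+1) ω).2 = Op.OW ∧ n - ones (X (t+1) ω).1 ≤ h}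

lemma goodAt_meas (hX : ∀ t, Measurable (X t)) (h t : ℕ) : MeasurableSet (goodAt X h t) :=
  (meas_stay hX t).inter (meas_set hX (t+1) {s | s.2 = Op.OW ∧ n - ones s.1 ≤ h})

lemma goodAt_mass (f : Point n → ℝ) (p q : ℝ) (hc : IsMMAHH μ X f p q) (h t : ℕ) :
    μ (goodAt X h t) = ∑ x', μ {ω | (∀ i ≤ t, (X i ω).2 = Op.OI) ∧ X (t+1) ω = (x', Op.OW)} *
      ENNReal.ofReal (ind h (n - ones x')) := by
  classical
  have : ∀ x' : Point n, μ {ω | (∀ i ≤ t, (X i ω).2 = Op.OI) ∧ X (t+1) ω = (x', Op.OW)} *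
      ENNReal.ofReal (ind h (n - ones x')) = if n - ones x' ≤ h then
        μ {ω | (∀ i ≤ t, (X i ω).2 = Op.OI) ∧ X (t+1) ω = (x', Op.OW)} else 0 := by
    intro x'; unfold ind; split_ifs <;> simp
  simp_rw [this]
  rw [← Finset.sum_filter, ← measure_biUnion_finset]
  · congr 1; ext ω
    simp only [goodAt, Set.mem_ofPred_eq, Set.mem_iUnion, Finset.mem_filter, Finset.mem_univ,
      true_and, exists_prop, Prod.ext_iff]
    constructor
    · rintro ⟨a, b, c⟩; exact ⟨_, c, a, rfl, b⟩
    · rintro ⟨x, c, a, rfl, b⟩; exact ⟨a, b, c⟩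
  · intro a _ b _ hab
    rw [Function.onFun, Set.disjoint_left]
    rintro ω ⟨_, h1⟩ ⟨_, h2⟩
    exact hab (congrArg Prod.fst (h1.symm.trans h2))
  · intro x _
    exact (meas_stay hc.1 t).inter (meas_set hc.1 (t+1) {(x, Op.OW)})

lemma telescope (hn : 2 ≤ n) (p q : ℝ) (h0 : 0 < p) (h1 : p < 1)
    (hc : IsMMAHH μ X (OneMax n) p q) (h N : ℕ) :
    ∑ t ∈ Finset.range N, μ (goodAt X h t)
      + ∑ x, stayMass μ X N x * ENNReal.ofReal (gval n p h (n - ones x))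
      = ∑ x, stayMass μ X 0 x * ENNReal.ofReal (gval n p h (n - ones x)) := by
  induction N with
  | zero => simp
  | succ N ih =>
    rw [Finset.sum_range_succ, ← ih, add_assoc]
    congr 1
    simp_rw [stay_succ]
    rw [goodAt_mass μ X _ p q hc, step_sum μ X _ p q hc N Op.OW
        (fun x => ENNReal.ofReal (ind h (n - ones x))),
      step_sum μ X _ p q hc N Op.OI (fun x => ENNReal.ofReal (gval n p h (n - ones x))),
      ← Finset.sum_add_distrib]
    refine Finset.sum_congr rfl fun x _ => ?_
    rw [← mul_add]
    congr 1
    exact harmonic_enn n hn p h0 h1 h x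

lemma decay_tendsto (p : ℝ) (h0 : 0 < p) :
    Filter.Tendsto (fun t => ENNReal.ofReal (1 - p) ^ t) Filter.atTop (nhds 0) := by
  apply ENNReal.tendsto_pow_atTop_nhds_zero_of_lt_one
  rw [← ENNReal.ofReal_one]
  exact (ENNReal.ofReal_lt_ofReal_iff one_pos).2 (by linarith)

lemma sum_good [IsProbabilityMeasure μ] (hn : 2 ≤ n) (p q : ℝ) (h0 : 0 < p) (h1 : p < 1)
    (hc : IsMMAHH μ X (OneMax n) p q) (h : ℕ) :
    ∑' t, μ (goodAt X h t)
      = ∑ x, stayMass μ X 0 x * ENNReal.ofReal (gval n p h (n - ones x)) := by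
  have hV : Filter.Tendsto
      (fun N => ∑ x, stayMass μ X N x * ENNReal.ofReal (gval n p h (n - ones x)))
      Filter.atTop (nhds 0) := by
    set C : ℝ≥0∞ := ∑ x : Point n, ENNReal.ofReal (gval n p h (n - ones x)) with hC
    have hCt : C ≠ ⊤ := by simp [hC]
    have ht : Filter.Tendsto (fun t => ENNReal.ofReal (1 - p) ^ t * C) Filter.atTop (nhds 0) := by
      simpa using ENNReal.Tendsto.mul_const (decay_tendsto p h0) (Or.inr hCt)
    refine tendsto_of_tendsto_of_tendsto_of_le_of_le tendsto_const_nhds ht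
      (fun _ => zero_le) (fun N => ?_)
    calc ∑ x, stayMass μ X N x * ENNReal.ofReal (gval n p h (n - ones x))
        ≤ ∑ x, stayMass μ X N x * C := by
          gcongr with x hx
          exact Finset.single_le_sum (f := fun x : Point n => ENNReal.ofReal (gval n p h (n - ones x)))
            (fun _ _ => zero_le) hx
      _ ≤ _ := by
        rw [← Finset.sum_mul]
        gcongr
        exact total_decay μ X hn _ p q hc N
  have h2 := (ENNReal.tendsto_nat_tsum (fun t => μ (goodAt X h t))).add hV
  simp_rw [telescope μ X hn p q h0 h1 hc h, add_zero] at h2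
  exact (tendsto_nhds_unique tendsto_const_nhds h2).symm

lemma switchTime_eq (ω : Ω) (t : ℕ) (hs : ∀ i ≤ t, (X i ω).2 = Op.OI)
    (ht : (X (t+1) ω).2 = Op.OW) : switchTime X 1 ω = t + 1 := by
  have h0 : (X 0 ω).2 = Op.OI := hs 0 (Nat.zero_le _)
  simp only [switchTime, h0, Nat.zero_le, true_and]
  apply le_antisymm
  · exact Nat.sInf_le (by simp [ht])
  · refine le_csInf ⟨t+1, by simp [ht]⟩ ?_
    intro b hb
    by_contra hlt
    exact hb (hs b (by omega))

lemma main_event [IsProbabilityMeasure μ] (hn : 2 ≤ n) (p q : ℝ) (h0 : 0 < p)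
    (hc : IsMMAHH μ X (OneMax n) p q) (h : ℕ) (x0 : Point n)
    (hinit : μ {ω | X 0 ω = (x0, Op.OI)} = 1) :
    μ {ω | n - ones (X (switchTime X 1 ω) ω).1 ≤ h} = ∑' t, μ (goodAt X h t) := by
  have hdis : Pairwise (Function.onFun Disjoint (goodAt X h)) := by
    intro a b hab
    rw [Function.onFun, Set.disjoint_left]
    rintro ω ⟨a1, a2, _⟩ ⟨b1, b2, _⟩
    have := switchTime_eq X ω a a1 a2
    have := switchTime_eq X ω b b1 b2
    omega
  rw [← measure_iUnion hdis (goodAt_meas X hc.1 h)]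
  apply measure_congr
  have hi : ∀ᵐ ω ∂μ, X 0 ω = (x0, Op.OI) := by
    exact (prob_compl_eq_zero_iff (meas_set hc.1 0 {(x0, Op.OI)})).2 hinit
  have hs : ∀ᵐ ω ∂μ, ∃ i, (X i ω).2 = Op.OW := by
    rw [ae_iff]
    refine le_antisymm (ge_of_tendsto' (decay_tendsto p h0) fun N => ?_) (zero_le)
    refine le_trans (measure_mono ?_)
      ((total_mass μ X hc.1 N).le.trans (total_decay μ X hn _ p q hc N))
    intro ω hω i _
    simp only [not_exists, Set.mem_ofPred_eq] at hω
    have := hω i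
    cases hx : (X i ω).2
    · rfl
    · exact absurd hx this
  filter_upwards [hi, hs] with ω hω hsω
  classical
  have hf := Nat.find_spec hsω
  have hmin : ∀ i < Nat.find hsω, (X i ω).2 = Op.OI := by
    intro i hi
    have := Nat.find_min hsω hi
    cases hx : (X i ω).2
    · rfl
    · exact absurd hx this
  obtain ⟨t, ht⟩ : ∃ t, Nat.find hsω = t + 1 := by
    refine Nat.exists_eq_succ_of_ne_zero fun h => ?_
    rw [h, hω] at hf
    cases hf
  rw [ht] at hf hmin
  have hst := switchTime_eq X ω t (fun i hi => hmin i (by omega)) hf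
  apply propext
  change n - ones (X (switchTime X 1 ω) ω).1 ≤ h ↔ ω ∈ ⋃ i, goodAt X h i
  rw [Set.mem_iUnion]
  constructor
  · intro hg
    rw [hst] at hg
    exact ⟨t, fun i hi => hmin i (by omega), hf, hg⟩
  · rintro ⟨i, a, b, c⟩
    rw [switchTime_eq X ω i a b]
    exact c

lemma start_sum [IsProbabilityMeasure μ] (hX : ∀ t, Measurable (X t)) (x0 : Point n)
    (hinit : μ {ω | X 0 ω = (x0, Op.OI)} = 1) (g : Point n → ℝ≥0∞) :
    ∑ x, stayMass μ X 0 x * g x = g x0 := by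
  classical
  have hz := (prob_compl_eq_zero_iff (meas_set hX 0 {(x0, Op.OI)})).2 hinit
  rw [Finset.sum_eq_single x0]
  · have : stayMass μ X 0 x0 = 1 := by
      rw [← hinit, stayMass]
      congr 1; ext ω; simp [Prod.ext_iff, and_comm]
    rw [this, one_mul]
  · intro b _ hb
    have : stayMass μ X 0 b = 0 := by
      refine measure_mono_null ?_ hz
      rintro ω ⟨_, h2⟩ h3
      apply hb
      have h4 : X 0 ω = (x0, Op.OI) := h3
      rw [← h2, h4]
    rw [this, zero_mul]
  · simp

end main

/-- Probability of reaching layer `h` in one OI phase on OneMax (Lemma 1 of the paper). -/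
theorem oi_phase_prob (n : ℕ) (hn : 2 ≤ n) (p q : ℝ)
    (hp0 : 0 < p) (hp1 : p < 1) (hq0 : 0 < q) (hq1 : q < 1)
    (k h : ℕ) (hk : k ≤ n) (hh : h ≤ n) (x0 : Point n) (hx0 : n - ones x0 = k)
    (Ω : Type) [MeasurableSpace Ω] (μ : Measure Ω) (X : ℕ → Ω → Point n × Op)
    (hprob : IsProbabilityMeasure μ) (hchain : IsMMAHH μ X (OneMax n) p q)
    (hinit : μ {ω | X 0 ω = (x0, Op.OI)} = 1) :
    (k ≤ h → μ {ω | n - ones (X (switchTime X 1 ω) ω).1 ≤ h} = 1) ∧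
    (h < k → μ {ω | n - ones (X (switchTime X 1 ω) ω).1 ≤ h} =
      ENNReal.ofReal ((1 / (1 - p)) *
        (Real.Gamma ((k : ℝ) + 1) * Real.Gamma ((n : ℝ) * p / (1 - p) + (h : ℝ) + 1)) /
        (Real.Gamma ((h : ℝ) + 1) * Real.Gamma ((n : ℝ) * p / (1 - p) + (k : ℝ) + 1)))) := by
  have key : μ {ω | n - ones (X (switchTime X 1 ω) ω).1 ≤ h} = ENNReal.ofReal (gval n p h k) := by
    rw [main_event μ X hn p q hp0 hchain h x0 hinit, sum_good μ X hn p q hp0 hp1 hchain h,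
      start_sum μ X hchain.1 x0 hinit, hx0]
  rw [key]
  constructor
  · intro hkh
    simp [gval, hkh]
  · intro hkh
    rw [gval, if_neg (by omega), gform]
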